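/- arXiv:2601.19055 — 7 statements merged into one kernel-verified Lean document; each statement's English description precedes it below -/
import Mathlib

section
/- Let Y be a finite nonempty set, let q be a Markov kernel on Y, and let π* be a pmf on Y such that q satisfies the balance equation with respect to π*. Suppose moreover there exist y* ∈ Y and γ ∈ [0,1] such that q(y*|y) ≥ γ for every y ∈ Y. Then for every pmf π on Y, TV(q∘π, π*) ≤ (1 − γ) · TV(π, π*). -/
/-- contraction of the pushforward by a Markov kernel satisfying the
balance equation w.r.t. `πs`, when some `ystar` receives mass at least `γ` from
every `y`.  Here `q y' y` denotes `q(y' | y)` and total variation distance between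
pmfs `p, r` is `(1/2) * ∑ y, |p y - r y|`. -/
theorem stmt_1 {Y : Type*} [Fintype Y] [Nonempty Y]
    (q : Y → Y → ℝ) (πs : Y → ℝ)
    (hq_nonneg : ∀ y y' : Y, 0 ≤ q y' y)
    (hq_sum : ∀ y : Y, ∑ y' : Y, q y' y = 1)
    (hπs_nonneg : ∀ y : Y, 0 ≤ πs y)
    (hπs_sum : ∑ y : Y, πs y = 1)
    (hbal : ∀ y y' : Y, q y' y * πs y = q y y' * πs y')
    (ystar : Y) (γ : ℝ) (hγ0 : 0 ≤ γ) (hγ1 : γ ≤ 1)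
    (hmin : ∀ y : Y, γ ≤ q ystar y)
    (π : Y → ℝ)
    (hπ_nonneg : ∀ y : Y, 0 ≤ π y)
    (hπ_sum : ∑ y : Y, π y = 1) :
    (1 / 2) * ∑ y' : Y, |(∑ y : Y, q y' y * π y) - πs y'| ≤
      (1 - γ) * ((1 / 2) * ∑ y : Y, |π y - πs y|) := by
  classical
  have key : ∀ y' : Y, |(∑ y : Y, q y' y * π y) - πs y'| ≤
      ∑ y : Y, (q y' y - if y' = ystar then γ else 0) * |π y - πs y| := by
    intro y'
    have hst : ∑ y : Y, q y' y * πs y = πs y' := by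
      rw [Finset.sum_congr rfl (fun y _ => hbal y y'), ← Finset.sum_mul, hq_sum, one_mul]
    have h1 : (∑ y : Y, q y' y * π y) - πs y' =
        ∑ y : Y, (q y' y - if y' = ystar then γ else 0) * (π y - πs y) := by
      simp only [sub_mul, mul_sub, Finset.sum_sub_distrib, ← Finset.mul_sum, hst, hπ_sum, hπs_sum]
      ring
    rw [h1]
    refine (Finset.abs_sum_le_sum_abs _ _).trans (le_of_eq (Finset.sum_congr rfl ?_))
    intro y _
    rw [abs_mul, abs_of_nonneg]
    split_ifs with h
    · subst h
      exact sub_nonneg.2 (hmin y)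
    · simpa using hq_nonneg y y'
  have h2 : ∑ y' : Y, |(∑ y : Y, q y' y * π y) - πs y'| ≤ (1 - γ) * ∑ y : Y, |π y - πs y| := by
    refine (Finset.sum_le_sum fun y' _ => key y').trans (le_of_eq ?_)
    rw [Finset.sum_comm, Finset.mul_sum]
    refine Finset.sum_congr rfl fun y _ => ?_
    rw [← Finset.sum_mul, Finset.sum_sub_distrib, hq_sum]
    simp
  linarith
end

section
/- Let X and Y be finite nonempty sets, let ρ be a pmf on X, let c : X × Y → ℝ satisfy 0 ≤ c(x,y) ≤ c_max for all x, y with c_max ≥ 0, let β > 0, and for each x ∈ X let π_ref(·|x) be a pmf on Y with π_ref(y|x) > 0 for all y. Let π*(·|x) be the Gibbs pmf for cost c(x,·), reference π_ref(·|x), and parameter β. Let π(·|x) be pmfs on Y such that π(y|x) > 0 for all x, y, and suppose there is V_max > 0 with |β log(π(y|x)/π_ref(y|x))| ≤ V_max and |β log(π*(y|x)/π_ref(y|x))| ≤ V_max for all x, y. Define J_β(π) = Σ_{x∈X} ρ(x) Σ_{y∈Y} π(y|x) [ c(x,y) + β log(π(y|x)/π_ref(y|x)) ]. If Σ_{x∈X}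 ρ(x) TV(π(·|x), π*(·|x)) ≤ ε, then J_β(π) − J_β(π*) ≤ 2 ε (c_max + V_max). -/
/-- TV to regularized suboptimality.  Here `π x y` denotes
`π(y | x)`, and `πs(·|x)` is the Gibbs pmf for cost `c x ·`, reference
`πref(·|x)` and parameter `β`. -/
theorem stmt_4 {X Y : Type*} [Fintype X] [Nonempty X] [Fintype Y] [Nonempty Y]
    (ρ : X → ℝ) (hρ_nonneg : ∀ x : X, 0 ≤ ρ x) (hρ_sum : ∑ x : X, ρ x = 1)
    (c : X → Y → ℝ) (cmax : ℝ) (hcmax : 0 ≤ cmax)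
    (hc : ∀ x y, 0 ≤ c x y ∧ c x y ≤ cmax)
    (β : ℝ) (hβ : 0 < β)
    (πref : X → Y → ℝ)
    (href_pos : ∀ x y, 0 < πref x y) (href_sum : ∀ x, ∑ y : Y, πref x y = 1)
    (πs : X → Y → ℝ)
    (hπs : ∀ x y, πs x y =
      πref x y * Real.exp (-c x y / β) /
        (∑ y' : Y, πref x y' * Real.exp (-c x y' / β)))
    (π : X → Y → ℝ)
    (hπ_pos : ∀ x y, 0 < π x y) (hπ_sum : ∀ x, ∑ y : Y, π x y = 1)
    (Vmax : ℝ) (hVmax : 0 < Vmax)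
    (hV : ∀ x y, |β * Real.log (π x y / πref x y)| ≤ Vmax)
    (hVs : ∀ x y, |β * Real.log (πs x y / πref x y)| ≤ Vmax)
    (ε : ℝ)
    (hTV : ∑ x : X, ρ x * ((1 / 2) * ∑ y : Y, |π x y - πs x y|) ≤ ε) :
    (∑ x : X, ρ x * ∑ y : Y, π x y * (c x y + β * Real.log (π x y / πref x y))) -
      (∑ x : X, ρ x * ∑ y : Y, πs x y * (c x y + β * Real.log (πs x y / πref x y)))
      ≤ 2 * ε * (cmax + Vmax) := by
  have hZ : ∀ x, 0 < ∑ y' : Y, πref x y' * Real.exp (-c x y' / β) := fun x =>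
    Finset.sum_pos (fun y _ => mul_pos (href_pos x y) (Real.exp_pos _)) Finset.univ_nonempty
  have hs_pos : ∀ x y, 0 < πs x y := fun x y => by
    rw [hπs]
    exact div_pos (mul_pos (href_pos x y) (Real.exp_pos _)) (hZ x)
  have hs_sum : ∀ x, ∑ y : Y, πs x y = 1 := fun x => by
    simp_rw [hπs]
    rw [← Finset.sum_div]
    exact div_self (hZ x).ne'
  have key : ∀ x y, π x y * (c x y + β * Real.log (π x y / πref x y))
      - πs x y * (c x y + β * Real.log (πs x y / πref x y))
      ≤ |π x y - πs x y| * (cmax + Vmax) + β * (π x y - πs x y) := fun x y => by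
    have hp := hπ_pos x y
    have hs := hs_pos x y
    have hr := href_pos x y
    have h1 : (π x y - πs x y) * (c x y + β * Real.log (π x y / πref x y))
        ≤ |π x y - πs x y| * (cmax + Vmax) := by
      refine (le_abs_self _).trans ?_
      rw [abs_mul]
      refine mul_le_mul_of_nonneg_left ?_ (abs_nonneg _)
      refine (abs_add_le _ _).trans (add_le_add ?_ (hV x y))
      rw [abs_of_nonneg (hc x y).1]
      exact (hc x y).2
    have h2 : πs x y * (Real.log (π x y) - Real.log (πs x y)) ≤ π x y - πs x y := by
      rw [← Real.log_div hp.ne' hs.ne']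
      have h := mul_le_mul_of_nonneg_left (Real.log_le_sub_one_of_pos (div_pos hp hs)) hs.le
      have e : πs x y * (π x y / πs x y - 1) = π x y - πs x y := by
        field_simp
      linarith
    have h3 := mul_le_mul_of_nonneg_left h2 hβ.le
    rw [Real.log_div hp.ne' hr.ne'] at h1 ⊢
    rw [Real.log_div hs.ne' hr.ne']
    linarith
  have keyx : ∀ x, (∑ y : Y, π x y * (c x y + β * Real.log (π x y / πref x y)))
      - (∑ y : Y, πs x y * (c x y + β * Real.log (πs x y / πref x y)))
      ≤ (∑ y : Y, |π x y - πs x y|) * (cmax + Vmax) := fun x => by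
    have h := Finset.sum_le_sum (fun y (_ : y ∈ Finset.univ) => key x y)
    rw [Finset.sum_sub_distrib, Finset.sum_add_distrib, ← Finset.sum_mul, ← Finset.mul_sum,
      Finset.sum_sub_distrib, hπ_sum, hs_sum] at h
    linarith
  have hfin : (∑ x : X, ρ x * ∑ y : Y, π x y * (c x y + β * Real.log (π x y / πref x y))) -
      (∑ x : X, ρ x * ∑ y : Y, πs x y * (c x y + β * Real.log (πs x y / πref x y)))
      ≤ (∑ x : X, ρ x * ((1 / 2) * ∑ y : Y, |π x y - πs x y|)) * (2 * (cmax + Vmax)) := by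
    rw [← Finset.sum_sub_distrib, Finset.sum_mul]
    refine Finset.sum_le_sum fun x _ => ?_
    have h := mul_le_mul_of_nonneg_left (keyx x) (hρ_nonneg x)
    linarith
  have h := mul_le_mul_of_nonneg_right hTV (by positivity : 0 ≤ 2 * (cmax + Vmax))
  linarith
end

section
/- Let Y be a finite nonempty set, let π_ref be a pmf on Y with π_ref(y) > 0 for all y, let c : Y → ℝ, let β > 0, and let π* be the Gibbs pmf. Let q be a Markov kernel on Y with q(y'|y) > 0 for all y, y' that satisfies the balance equation with respect to π*. Then for all ỹ, ỹ' ∈ Y, the probability of preferring ỹ' over ỹ in the induced preference distribution satisfies the Bradley–Terry form: π_ref(ỹ) q(ỹ'|ỹ) / ( π_ref(ỹ) q(ỹ'|ỹ) + π_ref(ỹ') q(ỹ|ỹ') ) = σ( (c(ỹ) − c(ỹ')) / β ). -/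
/-- the induced preference distribution satisfies the Bradley–Terry
form with respect to the cost `c`.  Here `q y' y` denotes `q(y' | y)` and
`σ(t) = 1 / (1 + exp (-t))`. -/
theorem stmt_5 {Y : Type*} [Fintype Y] [Nonempty Y]
    (πref : Y → ℝ) (c : Y → ℝ) (β : ℝ) (hβ : 0 < β)
    (href_pos : ∀ y : Y, 0 < πref y)
    (href_sum : ∑ y : Y, πref y = 1)
    (πs : Y → ℝ)
    (hπs : ∀ y : Y, πs y =
      πref y * Real.exp (-c y / β) /
        (∑ y' : Y, πref y' * Real.exp (-c y' / β)))
    (q : Y → Y → ℝ)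
    (hq_pos : ∀ y y' : Y, 0 < q y' y)
    (hq_sum : ∀ y : Y, ∑ y' : Y, q y' y = 1)
    (hbal : ∀ y y' : Y, q y' y * πs y = q y y' * πs y') :
    ∀ ty ty' : Y,
      πref ty * q ty' ty / (πref ty * q ty' ty + πref ty' * q ty ty') =
        1 / (1 + Real.exp (-((c ty - c ty') / β))) := by
  intro a b
  have hZ : 0 < ∑ y' : Y, πref y' * Real.exp (-c y' / β) :=
    Finset.sum_pos (fun y _ => mul_pos (href_pos y) (Real.exp_pos _)) Finset.univ_nonempty
  have h := hbal a b
  rw [hπs a, hπs b, ← mul_div_assoc, ← mul_div_assoc, div_left_inj' hZ.ne'] at h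
  have hA : 0 < πref a * q b a := mul_pos (href_pos a) (hq_pos a b)
  have he : Real.exp (-c a / β) = Real.exp (-((c a - c b) / β)) * Real.exp (-c b / β) := by
    rw [← Real.exp_add]
    congr 1
    ring
  have hB : πref b * q a b = πref a * q b a * Real.exp (-((c a - c b) / β)) := by
    rw [he] at h
    apply mul_right_cancel₀ (Real.exp_pos (-c b / β)).ne'
    linarith
  have hE := Real.exp_pos (-((c a - c b) / β))
  rw [hB, div_eq_div_iff (by positivity) (by positivity)]
  ring
end

section
/- Let a, b, A, B be real numbers with |a| ≤ A and |b| ≤ B. Then |σ(a) − σ(b)| ≥ min(σ'(A), σ'(B)) · |a − b|. -/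
lemma aux_form (C : ℝ) : Real.exp (-C) / (1 + Real.exp (-C)) ^ 2
    = Real.sigmoid C * (1 - Real.sigmoid C) := by
  rw [Real.sigmoid_def]
  have := Real.exp_pos (-C)
  field_simp
  ring

lemma aux_lt (a b C : ℝ) (ha : |a| ≤ C) (hb : |b| ≤ C) (hab : a < b) :
    Real.sigmoid C * (1 - Real.sigmoid C) * |a - b| ≤ |Real.sigmoid a - Real.sigmoid b| := by
  obtain ⟨c, hc, he⟩ := exists_hasDerivAt_eq_slope Real.sigmoid
    (fun x => Real.sigmoid x * (1 - Real.sigmoid x)) hab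
    continuous_sigmoid.continuousOn (fun x _ => Real.hasDerivAt_sigmoid x)
  have h1 := (abs_le.1 ha).1
  have h2 := (abs_le.1 hb).2
  have h3 : Real.sigmoid c ≤ Real.sigmoid C := Real.sigmoid_le (by linarith [hc.2])
  have h4 : Real.sigmoid (-C) ≤ Real.sigmoid c := Real.sigmoid_le (by linarith [hc.1])
  rw [Real.sigmoid_neg] at h4
  have h5 := Real.sigmoid_lt hab
  have hd : 0 < b - a := by linarith
  rw [eq_div_iff hd.ne'] at he
  rw [abs_of_neg (by linarith), abs_of_neg (by linarith), neg_sub, neg_sub, ← he]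
  apply mul_le_mul_of_nonneg_right _ hd.le
  nlinarith [mul_nonneg (sub_nonneg.2 h3) (sub_nonneg.2 h4)]

lemma aux_all (a b C : ℝ) (ha : |a| ≤ C) (hb : |b| ≤ C) :
    Real.sigmoid C * (1 - Real.sigmoid C) * |a - b| ≤ |Real.sigmoid a - Real.sigmoid b| := by
  rcases lt_trichotomy a b with h | h | h
  · exact aux_lt a b C ha hb h
  · simp [h]
  · rw [abs_sub_comm a b, abs_sub_comm (Real.sigmoid a)]
    exact aux_lt b a C hb ha h

/-- sigmoid lower bound with bounded arguments.  Here
`σ t = 1 / (1 + exp (-t))` and `σ' t = exp (-t) / (1 + exp (-t))^2`. -/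
theorem stmt_11 (a b A B : ℝ) (hA : |a| ≤ A) (hB : |b| ≤ B) :
    |1 / (1 + Real.exp (-a)) - 1 / (1 + Real.exp (-b))| ≥
      min (Real.exp (-A) / (1 + Real.exp (-A)) ^ 2)
          (Real.exp (-B) / (1 + Real.exp (-B)) ^ 2) * |a - b| := by
  rw [aux_form, aux_form, one_div, one_div, ← Real.sigmoid_def, ← Real.sigmoid_def]
  rcases le_total A B with h | h
  · exact (mul_le_mul_of_nonneg_right (min_le_right _ _) (abs_nonneg _)).trans
      (aux_all a b B (hA.trans h) hB)
  · exact (mul_le_mul_of_nonneg_right (min_le_left _ _) (abs_nonneg _)).trans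
      (aux_all a b A hA (hB.trans h))
end

section
/- Let X and Y be finite nonempty sets, let ρ be a pmf on X, and for each x ∈ X let π_ref(·|x), π*(·|x), and π̂(·|x) be pmfs on Y. For each x ∈ X let q(·|x,·) be a Markov kernel on Y that satisfies the balance equation with respect to π*(·|x), and suppose there are γ_min : X → [0,1] and, for each x, an element y*(x) ∈ Y with q(y*(x)|x,y) ≥ γ_min(x) for all y ∈ Y. Define (q∘π_ref)(y'|x) = Σ_{y∈Y} q(y'|x,y) π_ref(y|x), and let D = Σ_{x∈X} ρ(x) TV(π_ref(·|x), π*(·|x)), η_max = 1 − min_{x∈X} γ_min(x), and η̄_max = sqrt( Σ_{x∈X} ρ(x) (1 − γ_min(x))² ). If Σ_{x∈X} ρ(x) TV(π̂(·|x), (q∘π_ref)(·|x)) ≤ Δ for some Δ ≥ 0, then Σ_{x∈X} ρ(x) TV(π̂(·|x), π*(·|x)) ≤ Δ + min( η_max · D, η̄_max · sqrt(D) ). -/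
theorem contraction_aux {Y : Type*} [Fintype Y] (p s : Y → ℝ)
    (hp : ∑ y, p y = 1) (hs : ∑ y, s y = 1) (q : Y → Y → ℝ)
    (hq0 : ∀ y y', 0 ≤ q y' y) (hq : ∀ y, ∑ y', q y' y = 1)
    (hbal : ∀ y y', q y' y * s y = q y y' * s y') (γ : ℝ) (ys : Y)
    (hmin : ∀ y, γ ≤ q ys y) :
    ∑ y', |∑ y, q y' y * p y - s y'| ≤ (1 - γ) * ∑ y, |p y - s y| := by
  classical
  have key : ∀ y', ∑ y, q y' y * p y - s y'
      = ∑ y, (q y' y - if y' = ys then γ else 0) * (p y - s y) := by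
    intro y'
    have h1 : ∑ y, q y' y * s y = s y' := by
      rw [Finset.sum_congr rfl (fun y _ => hbal y y'), ← Finset.sum_mul, hq, one_mul]
    have h2 : ∑ y, (q y' y - if y' = ys then γ else 0) * (p y - s y)
        = ∑ y, q y' y * p y - ∑ y, q y' y * s y
          - (if y' = ys then γ else 0) * (∑ y, p y - ∑ y, s y) := by
      rw [← Finset.sum_sub_distrib, ← Finset.sum_sub_distrib, Finset.mul_sum,
        ← Finset.sum_sub_distrib]
      exact Finset.sum_congr rfl (fun y _ => by ring)
    rw [h2, h1, hp, hs]; ring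
  calc ∑ y', |∑ y, q y' y * p y - s y'|
      ≤ ∑ y', ∑ y, (q y' y - if y' = ys then γ else 0) * |p y - s y| := by
        refine Finset.sum_le_sum (fun y' _ => ?_)
        rw [key]
        refine (Finset.abs_sum_le_sum_abs _ _).trans (Finset.sum_le_sum (fun y _ => ?_))
        rw [abs_mul, abs_of_nonneg]
        split_ifs with h
        · subst h; linarith [hmin y]
        · linarith [hq0 y y']
    _ = (1 - γ) * ∑ y, |p y - s y| := by
        rw [Finset.sum_comm, Finset.mul_sum]
        refine Finset.sum_congr rfl (fun y _ => ?_)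
        rw [← Finset.sum_mul, Finset.sum_sub_distrib, hq]
        simp

/-- SFT-style bound.  Here `q x y' y` denotes `q(y' | x, y)`,
`π x y` denotes `π(y | x)`, and TV is written out as `(1/2) * ∑ |·|`. -/
theorem stmt_12 {X Y : Type*} [Fintype X] [Nonempty X] [Fintype Y] [Nonempty Y]
    (ρ : X → ℝ) (hρ_nonneg : ∀ x : X, 0 ≤ ρ x) (hρ_sum : ∑ x : X, ρ x = 1)
    (πref πs πhat : X → Y → ℝ)
    (href_nonneg : ∀ x y, 0 ≤ πref x y) (href_sum : ∀ x, ∑ y : Y, πref x y = 1)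
    (hπs_nonneg : ∀ x y, 0 ≤ πs x y) (hπs_sum : ∀ x, ∑ y : Y, πs x y = 1)
    (hhat_nonneg : ∀ x y, 0 ≤ πhat x y) (hhat_sum : ∀ x, ∑ y : Y, πhat x y = 1)
    (q : X → Y → Y → ℝ)
    (hq_nonneg : ∀ x y y', 0 ≤ q x y' y)
    (hq_sum : ∀ x y, ∑ y' : Y, q x y' y = 1)
    (hbal : ∀ x y y', q x y' y * πs x y = q x y y' * πs x y')
    (γmin : X → ℝ) (hγ0 : ∀ x, 0 ≤ γmin x) (hγ1 : ∀ x, γmin x ≤ 1)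
    (ystar : X → Y)
    (hmin : ∀ x y, γmin x ≤ q x (ystar x) y)
    (D ηmax η'max : ℝ)
    (hD : D = ∑ x : X, ρ x * ((1 / 2) * ∑ y : Y, |πref x y - πs x y|))
    (hηmax : ηmax = 1 - Finset.univ.inf' Finset.univ_nonempty γmin)
    (hη'max : η'max = Real.sqrt (∑ x : X, ρ x * (1 - γmin x) ^ 2))
    (Δ : ℝ) (hΔ : 0 ≤ Δ)
    (hMLE : ∑ x : X, ρ x *
        ((1 / 2) * ∑ y' : Y, |πhat x y' - ∑ y : Y, q x y' y * πref x y|) ≤ Δ) :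
    ∑ x : X, ρ x * ((1 / 2) * ∑ y : Y, |πhat x y - πs x y|) ≤
      Δ + min (ηmax * D) (η'max * Real.sqrt D) := by
  set T : X → ℝ := fun x => (1 / 2) * ∑ y : Y, |πref x y - πs x y| with hT
  have hT0 : ∀ x, 0 ≤ T x := fun x => by simp only [hT]; positivity
  have hT1 : ∀ x, T x ≤ 1 := by
    intro x
    have : ∑ y : Y, |πref x y - πs x y| ≤ ∑ y : Y, (πref x y + πs x y) :=
      Finset.sum_le_sum (fun y _ => by
        rw [abs_le]; constructor <;> linarith [href_nonneg x y, hπs_nonneg x y])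
    rw [Finset.sum_add_distrib, href_sum, hπs_sum] at this
    simp only [hT]; linarith
  have hD' : D = ∑ x, ρ x * T x := hD
  have main : ∑ x : X, ρ x * ((1 / 2) * ∑ y : Y, |πhat x y - πs x y|) ≤
      Δ + ∑ x, ρ x * ((1 - γmin x) * T x) := by
    refine le_trans ?_ (add_le_add_left hMLE _)
    rw [← Finset.sum_add_distrib]
    refine Finset.sum_le_sum (fun x _ => ?_)
    rw [← mul_add]
    refine mul_le_mul_of_nonneg_left ?_ (hρ_nonneg x)
    have hc := contraction_aux (πref x) (πs x) (href_sum x) (hπs_sum x) (q x)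
      (hq_nonneg x) (hq_sum x) (hbal x) (γmin x) (ystar x) (hmin x)
    have ht : ∑ y : Y, |πhat x y - πs x y| ≤
        ∑ y' : Y, |πhat x y' - ∑ y : Y, q x y' y * πref x y|
          + ∑ y' : Y, |∑ y, q x y' y * πref x y - πs x y'| := by
      rw [← Finset.sum_add_distrib]
      exact Finset.sum_le_sum (fun y _ => abs_sub_le _ _ _)
    simp only [hT]
    linarith
  refine main.trans (add_le_add le_rfl (le_min ?_ ?_))
  · rw [hD', Finset.mul_sum]
    refine Finset.sum_le_sum (fun x _ => ?_)
    have h1 : 1 - γmin x ≤ ηmax := by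
      rw [hηmax]
      linarith [Finset.inf'_le γmin (Finset.mem_univ x)]
    have := mul_le_mul_of_nonneg_right h1 (mul_nonneg (hρ_nonneg x) (hT0 x))
    linarith
  · have hA : 0 ≤ ∑ x : X, ρ x * (1 - γmin x) ^ 2 :=
      Finset.sum_nonneg (fun x _ => mul_nonneg (hρ_nonneg x) (sq_nonneg _))
    have hcs : (∑ x, ρ x * ((1 - γmin x) * T x)) ^ 2
        ≤ (∑ x : X, ρ x * (1 - γmin x) ^ 2) * ∑ x, ρ x * T x ^ 2 :=
      Finset.sum_sq_le_sum_mul_sum_of_sq_eq_mul _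
        (fun x _ => mul_nonneg (hρ_nonneg x) (sq_nonneg _))
        (fun x _ => mul_nonneg (hρ_nonneg x) (sq_nonneg _)) (fun x _ => by ring)
    have hTT : ∑ x, ρ x * T x ^ 2 ≤ D := by
      rw [hD']
      refine Finset.sum_le_sum (fun x _ => mul_le_mul_of_nonneg_left ?_ (hρ_nonneg x))
      nlinarith [hT0 x, hT1 x]
    rw [hη'max, ← Real.sqrt_mul hA]
    exact Real.le_sqrt_of_sq_le (hcs.trans (mul_le_mul_of_nonneg_left hTT hA))
end

section
/- Let Y be a finite nonempty set and let p and r be pmfs on Y with p(y) > 0 and r(y) > 0 for all y ∈ Y. Then Σ_{y∈Y} Σ_{y'∈Y} (1/2) ( p(y') r(y) + r(y') p(y) ) · | log( p(y') r(y) / ( r(y') p(y) ) ) | ≥ TV(p, r). -/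
theorem aux_log_ge {a b : ℝ} (ha : 0 < a) (hb : 0 < b) (hab : b ≤ a) :
    (1 / 2) * |a - b| ≤ (1 / 2) * (a + b) * |Real.log (a / b)| := by
  have h1 : 1 - (a / b)⁻¹ ≤ Real.log (a / b) := Real.one_sub_inv_le_log_of_pos (by positivity)
  have h2 : 0 ≤ Real.log (a / b) := Real.log_nonneg ((one_le_div hb).2 hab)
  rw [abs_of_nonneg h2, abs_of_nonneg (sub_nonneg.2 hab)]
  have h3 : a * (1 - (a / b)⁻¹) = a - b := by field_simp
  have h4 := mul_le_mul_of_nonneg_left h1 ha.le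
  have h5 := mul_nonneg hb.le h2
  nlinarith

theorem aux_log {a b : ℝ} (ha : 0 < a) (hb : 0 < b) :
    (1 / 2) * |a - b| ≤ (1 / 2) * (a + b) * |Real.log (a / b)| := by
  rcases le_total b a with h | h
  · exact aux_log_ge ha hb h
  · have := aux_log_ge hb ha h
    rwa [abs_sub_comm, add_comm b a, ← inv_div a b, Real.log_inv, abs_neg] at this

/-- lower-bounding a symmetrized log-ratio expectation by the
total variation distance. -/
theorem stmt_13 {Y : Type*} [Fintype Y] [Nonempty Y]
    (p r : Y → ℝ)
    (hp_pos : ∀ y : Y, 0 < p y) (hp_sum : ∑ y : Y, p y = 1)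
    (hr_pos : ∀ y : Y, 0 < r y) (hr_sum : ∑ y : Y, r y = 1) :
    ∑ y : Y, ∑ y' : Y,
        (1 / 2) * (p y' * r y + r y' * p y) *
          |Real.log (p y' * r y / (r y' * p y))| ≥
      (1 / 2) * ∑ y : Y, |p y - r y| := by
  rw [ge_iff_le, Finset.mul_sum]
  refine Finset.sum_le_sum fun y _ => ?_
  have h : ∑ y' : Y, (p y' * r y - r y' * p y) = r y - p y := by
    rw [Finset.sum_sub_distrib, ← Finset.sum_mul, ← Finset.sum_mul, hp_sum, hr_sum, one_mul,
      one_mul]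
  calc (1 / 2) * |p y - r y| = (1 / 2) * |∑ y' : Y, (p y' * r y - r y' * p y)| := by
        rw [h, abs_sub_comm]
    _ ≤ (1 / 2) * ∑ y' : Y, |p y' * r y - r y' * p y| := by
        gcongr
        exact Finset.abs_sum_le_sum_abs _ _
    _ = ∑ y' : Y, (1 / 2) * |p y' * r y - r y' * p y| := Finset.mul_sum _ _ _
    _ ≤ _ := Finset.sum_le_sum fun y' _ =>
        aux_log (mul_pos (hp_pos y') (hr_pos y)) (mul_pos (hr_pos y') (hp_pos y))
end

section
/- Let X and Y be finite nonempty sets, let ρ be a pmf on X, and for each x ∈ X let π(·|x) and π*(·|x) be pmfs on Y. For each x ∈ X let q(·|x,·) be a Markov kernel on Y that satisfies the balance equation with respect to π*(·|x), and suppose there are γ_min : X → [0,1] and, for each x, an element y*(x) ∈ Y with q(y*(x)|x,y) ≥ γ_min(x) for all y ∈ Y. Define (q∘π)(y'|x) = Σ_{y∈Y} q(y'|x,y) π(y|x). Then Σ_{x∈X} ρ(x) TV( (q∘π)(·|x), π*(·|x) ) ≤ Σ_{x∈X} ρ(x) (1 − γ_min(x)) TV( π(·|x), π*(·|x) ). 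-/
/-- contraction of the pushforward, averaged over contexts.
Here `q x y' y` denotes `q(y' | x, y)` and `π x y` denotes `π(y | x)`. -/
theorem stmt_15 {X Y : Type*} [Fintype X] [Nonempty X] [Fintype Y] [Nonempty Y]
    (ρ : X → ℝ) (hρ_nonneg : ∀ x : X, 0 ≤ ρ x) (hρ_sum : ∑ x : X, ρ x = 1)
    (π πs : X → Y → ℝ)
    (hπ_nonneg : ∀ x y, 0 ≤ π x y) (hπ_sum : ∀ x, ∑ y : Y, π x y = 1)
    (hπs_nonneg : ∀ x y, 0 ≤ πs x y) (hπs_sum : ∀ x, ∑ y : Y, πs x y = 1)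
    (q : X → Y → Y → ℝ)
    (hq_nonneg : ∀ x y y', 0 ≤ q x y' y)
    (hq_sum : ∀ x y, ∑ y' : Y, q x y' y = 1)
    (hbal : ∀ x y y', q x y' y * πs x y = q x y y' * πs x y')
    (γmin : X → ℝ) (hγ0 : ∀ x, 0 ≤ γmin x) (hγ1 : ∀ x, γmin x ≤ 1)
    (ystar : X → Y)
    (hmin : ∀ x y, γmin x ≤ q x (ystar x) y) :
    ∑ x : X, ρ x * ((1 / 2) * ∑ y' : Y, |(∑ y : Y, q x y' y * π x y) - πs x y'|) ≤
      ∑ x : X, ρ x * ((1 - γmin x) * ((1 / 2) * ∑ y : Y, |π x y - πs x y|)) := by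
  classical
  refine Finset.sum_le_sum fun x _ => mul_le_mul_of_nonneg_left ?_ (hρ_nonneg x)
  set e : Y → ℝ := fun y' => if y' = ystar x then γmin x else 0 with he
  have he_sum : ∑ y', e y' = γmin x := by simp [he]
  have hr : ∀ y' y, 0 ≤ q x y' y - e y' := by
    intro y' y
    by_cases h : y' = ystar x
    · subst h
      simpa [he] using hmin x y
    · simpa [he, h] using hq_nonneg x y y'
  have hstat : ∀ y', ∑ y, q x y' y * πs x y = πs x y' := by
    intro y'
    rw [Finset.sum_congr rfl fun y _ => hbal x y y', ← Finset.sum_mul, hq_sum, one_mul]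
  have hdiff : ∀ y', (∑ y, q x y' y * π x y) - πs x y'
      = ∑ y, (q x y' y - e y') * (π x y - πs x y) := by
    intro y'
    have h1 : ∑ y, (q x y' y - e y') * (π x y - πs x y)
        = (∑ y, q x y' y * π x y) - (∑ y, q x y' y * πs x y)
          - e y' * ((∑ y, π x y) - ∑ y, πs x y) := by
      rw [← Finset.sum_sub_distrib, ← Finset.sum_sub_distrib, Finset.mul_sum,
        ← Finset.sum_sub_distrib]
      exact Finset.sum_congr rfl fun y _ => by ring
    rw [h1, hstat, hπ_sum, hπs_sum]
    ring
  have key : ∑ y', |(∑ y, q x y' y * π x y) - πs x y'|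
      ≤ (1 - γmin x) * ∑ y, |π x y - πs x y| := by
    calc ∑ y', |(∑ y, q x y' y * π x y) - πs x y'|
        ≤ ∑ y', ∑ y, (q x y' y - e y') * |π x y - πs x y| := by
          refine Finset.sum_le_sum fun y' _ => ?_
          rw [hdiff]
          refine (Finset.abs_sum_le_sum_abs _ _).trans (le_of_eq ?_)
          exact Finset.sum_congr rfl fun y _ => by rw [abs_mul, abs_of_nonneg (hr y' y)]
      _ = (1 - γmin x) * ∑ y, |π x y - πs x y| := by
          rw [Finset.sum_comm, Finset.mul_sum]
          refine Finset.sum_congr rfl fun y _ => ?_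
          rw [← Finset.sum_mul, Finset.sum_sub_distrib, hq_sum, he_sum]
  linarith
end
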